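/- PAC-Bayes bound in expectation: for any λ > 0 and any data-dependent probability measure ρ̃ on Θ, E_S E_{θ∼ρ̃}[R(θ)] ≤ E_S [ E_{θ∼ρ̃}[r(θ)] + λC²/(8n) + KL(ρ̃‖π)/λ ]. In particular, for the Gibbs posterior ρ̂_λ with density proportional to exp(−λ r(θ)) with respect to π, E_S E_{θ∼ρ̂_λ}[R(θ)] ≤ E_S [ inf over ρ ∈ P(Θ) of ( E_{θ∼ρ}[r(θ)] + λC²/(8n) + KL(ρ‖π)/λ ) ]. -/

import Mathlib

open MeasureTheory
open scoped ENNReal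

/- Kullback-Leibler divergence: `∫ log (dρ/dπ) dρ` when `ρ ≪ π` (and the integral is
well-defined), `+∞` otherwise. -/
open Classical in
noncomputable def KL {Θ : Type*} [MeasurableSpace Θ] (ρ π : Measure Θ) : ℝ≥0∞ :=
  if ρ ≪ π ∧ Integrable (fun θ => Real.log ((ρ.rnDeriv π) θ).toReal) ρ
  then ENNReal.ofReal (∫ θ, Real.log ((ρ.rnDeriv π) θ).toReal ∂ρ)
  else ⊤

/- The risk `R(θ) = E_{(X,Y)∼P}[ℓ(f_θ(X),Y)]`. -/
noncomputable def risk {X Y Θ : Type*} [MeasurableSpace X] [MeasurableSpace Y]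
    (P : Measure (X × Y)) (f : Θ → X → Y) (ℓ : Y → Y → ℝ) (θ : Θ) : ℝ :=
  ∫ p, ℓ (f θ p.1) p.2 ∂P

/- The empirical risk `r(θ) = (1/n) ∑ᵢ ℓ(f_θ(Xᵢ),Yᵢ)` on the sample `ω`. -/
noncomputable def empRisk {X Y Θ : Type*} (f : Θ → X → Y) (ℓ : Y → Y → ℝ)
    (n : ℕ) (ω : Fin n → X × Y) (θ : Θ) : ℝ :=
  (∑ i, ℓ (f θ (ω i).1) (ω i).2) / n

/- The Gibbs posterior `ρ̂_λ`, with density proportional to `exp (-λ r θ)` w.r.t. `π`. -/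
noncomputable def gibbs {X Y Θ : Type*} [MeasurableSpace Θ] (π : Measure Θ)
    (f : Θ → X → Y) (ℓ : Y → Y → ℝ) (lam : ℝ) (n : ℕ) (ω : Fin n → X × Y) : Measure Θ :=
  π.tilted (fun θ => -lam * empRisk f ℓ n ω θ)

open ProbabilityTheory

lemma ofReal_integral_le_lintegral_ofReal {α : Type*} [MeasurableSpace α] {μ : Measure α}
    {g : α → ℝ} (hg : Integrable g μ) :
    ENNReal.ofReal (∫ a, g a ∂μ) ≤ ∫⁻ a, ENNReal.ofReal (g a) ∂μ := by
  rw [integral_eq_lintegral_pos_part_sub_lintegral_neg_part hg]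
  exact (ENNReal.ofReal_le_ofReal (sub_le_self _ ENNReal.toReal_nonneg)).trans
    ENNReal.ofReal_toReal_le

section Bounded

variable {α : Type*} [MeasurableSpace α] {μ : Measure α} [IsProbabilityMeasure μ] {h : α → ℝ}
  {b : ℝ}

lemma integrable_of_abs_le (hm : Measurable h) (hb : ∀ a, |h a| ≤ b) : Integrable h μ :=
  Integrable.of_bound hm.aestronglyMeasurable b (ae_of_all _ hb)

lemma integrable_exp_of_abs_le (hm : Measurable h) (hb : ∀ a, |h a| ≤ b) :
    Integrable (fun a => Real.exp (h a)) μ :=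
  integrable_of_abs_le (b := Real.exp b) hm.exp fun a => by
    rw [Real.abs_exp]
    exact Real.exp_le_exp.2 (abs_le.1 (hb a)).2

lemma integral_mem_Icc {c : ℝ} (hm : Measurable h) (hb : ∀ a, h a ∈ Set.Icc b c) :
    ∫ a, h a ∂μ ∈ Set.Icc b c := by
  have hi : Integrable h μ := Integrable.of_mem_Icc b c hm.aemeasurable (ae_of_all _ hb)
  constructor
  · simpa using integral_mono (integrable_const b) hi fun a => (hb a).1
  · simpa using integral_mono hi (integrable_const c) fun a => (hb a).2

lemma abs_log_integral_exp_le (hm : Measurable h) (hb : ∀ a, |h a| ≤ b) :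
    |Real.log (∫ a, Real.exp (h a) ∂μ)| ≤ b := by
  have hmem : ∫ a, Real.exp (h a) ∂μ ∈ Set.Icc (Real.exp (-b)) (Real.exp b) :=
    integral_mem_Icc hm.exp fun a =>
      ⟨Real.exp_le_exp.2 (abs_le.1 (hb a)).1, Real.exp_le_exp.2 (abs_le.1 (hb a)).2⟩
  have hpos := (Real.exp_pos _).trans_le hmem.1
  exact abs_le.2 ⟨(Real.le_log_iff_exp_le hpos).2 hmem.1, (Real.log_le_iff_le_exp hpos).2 hmem.2⟩

/-- The easy half of the Donsker-Varadhan variational formula. -/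
lemma integral_sub_log_integral_exp_le_integral_llr {ρ : Measure α} [IsProbabilityMeasure ρ]
    (hρ : ρ ≪ μ) (hllr : Integrable (llr ρ μ) ρ) (hm : Measurable h) (hb : ∀ a, |h a| ≤ b) :
    ∫ a, h a ∂ρ - Real.log (∫ a, Real.exp (h a) ∂μ) ≤ ∫ a, llr ρ μ a ∂ρ := by
  have hexp : Integrable (fun a => Real.exp (h a)) μ := integrable_exp_of_abs_le hm hb
  have := isProbabilityMeasure_tilted hexp
  have hkl := InformationTheory.toReal_klDiv_of_measure_eq
    (hρ.trans (absolutelyContinuous_tilted hexp)) (by simp)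
  rw [integral_llr_tilted_right hρ (integrable_of_abs_le hm hb) hexp hllr] at hkl
  linarith [ENNReal.toReal_nonneg (a := InformationTheory.klDiv ρ (μ.tilted h))]

lemma ofReal_integral_sub_log_integral_exp_le_KL {ρ : Measure α} [IsProbabilityMeasure ρ]
    (hm : Measurable h) (hb : ∀ a, |h a| ≤ b) :
    ENNReal.ofReal (∫ a, h a ∂ρ - Real.log (∫ a, Real.exp (h a) ∂μ)) ≤ KL ρ μ := by
  unfold KL
  split_ifs with hρ
  · exact ENNReal.ofReal_le_ofReal
      (integral_sub_log_integral_exp_le_integral_llr hρ.1 hρ.2 hm hb)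
  · exact le_top

lemma integral_le_log_integral_exp (hm : Measurable h) (hb : ∀ a, |h a| ≤ b) :
    ∫ a, h a ∂μ ≤ Real.log (∫ a, Real.exp (h a) ∂μ) := by
  have hself := llr_self μ
  have := integral_sub_log_integral_exp_le_integral_llr Measure.AbsolutelyContinuous.rfl
    ((integrable_zero α ℝ μ).congr hself.symm) hm hb
  rw [integral_congr_ae hself] at this
  simpa using this

/-- Hoeffding's lemma for the deviation of an empirical mean. -/
lemma integral_exp_mean_deviation_le (hm : Measurable h) (hb : ∀ a, h a ∈ Set.Icc 0 b)
    {n : ℕ} (hn : 0 < n) (t : ℝ) :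
    ∫ ω, Real.exp (t * (∫ a, h a ∂μ - (∑ i, h (ω i)) / n)) ∂(Measure.pi fun _ : Fin n => μ)
      ≤ Real.exp (t ^ 2 * b ^ 2 / (8 * n)) := by
  have hn' : (n : ℝ) ≠ 0 := by positivity
  have hmgf := (hasSubgaussianMGF_of_mem_Icc (μ := μ) hm.aemeasurable
    (ae_of_all _ hb)).mgf_le (-t / n)
  have hprod : ∀ ω : Fin n → α, Real.exp (t * (∫ a, h a ∂μ - (∑ i, h (ω i)) / n)) =
      ∏ i, Real.exp (-t / n * (h (ω i) - ∫ a, h a ∂μ)) := fun ω => by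
    rw [← Real.exp_sum, ← Finset.mul_sum, Finset.sum_sub_distrib]
    congr 1
    simp
    field_simp
    ring
  simp_rw [hprod]
  rw [integral_fintype_prod_eq_pow (fun a => Real.exp (-t / n * (h a - ∫ a, h a ∂μ)))]
  refine (pow_le_pow_left₀ (integral_nonneg fun a => (Real.exp_pos _).le) hmgf _).trans ?_
  rw [← Real.exp_nat_mul]
  refine (Real.exp_le_exp.2 (le_of_eq ?_))
  simp
  field_simp
  rw [sq_abs]
  ring

end Bounded

lemma empRisk_mem_Icc {X Y Θ : Type*} {f : Θ → X → Y} {ℓ : Y → Y → ℝ} {C : ℝ}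
    (hbound : ∀ y' y : Y, ℓ y' y ∈ Set.Icc 0 C)
    {n : ℕ} (hn : 0 < n)
    (ω : Fin n → X × Y) (θ : Θ) : empRisk f ℓ n ω θ ∈ Set.Icc 0 C := by
  have hn' : (0 : ℝ) < n := by positivity
  constructor
  · exact div_nonneg (Finset.sum_nonneg fun i _ => (hbound _ _).1) hn'.le
  · refine (div_le_iff₀ hn').2 ((Finset.sum_le_sum fun i _ => (hbound _ _).2).trans ?_)
    simp [mul_comm]

lemma abs_neg_mul_empRisk_le {X Y Θ : Type*} {f : Θ → X → Y} {ℓ : Y → Y → ℝ} {C lam : ℝ}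
    (hbound : ∀ y' y : Y, ℓ y' y ∈ Set.Icc 0 C) {n : ℕ} (hn : 0 < n) (hlam : 0 < lam)
    (ω : Fin n → X × Y) (θ : Θ) : |-lam * empRisk f ℓ n ω θ| ≤ lam * C := by
  have h := empRisk_mem_Icc (f := f) hbound hn ω θ
  rw [abs_mul, abs_neg, abs_of_pos hlam, abs_of_nonneg h.1]
  exact mul_le_mul_of_nonneg_left h.2 hlam.le

section Loss

variable {X Y Θ : Type*} [MeasurableSpace X] [MeasurableSpace Y] [MeasurableSpace Θ]
  {P : Measure (X × Y)} [IsProbabilityMeasure P] {f : Θ → X → Y} {ℓ : Y → Y → ℝ} {C : ℝ}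

lemma measurable_risk (hmeas : Measurable (fun p : Θ × X × Y => ℓ (f p.1 p.2.1) p.2.2)) :
    Measurable (risk P f ℓ) :=
  (hmeas.stronglyMeasurable.integral_prod_right' (ν := P)).measurable

lemma measurable_empRisk (hmeas : Measurable (fun p : Θ × X × Y => ℓ (f p.1 p.2.1) p.2.2))
    (n : ℕ) : Measurable (fun q : (Fin n → X × Y) × Θ => empRisk f ℓ n q.1 q.2) := by
  refine Measurable.div_const (Finset.measurable_sum _ fun i _ => ?_) _
  exact hmeas.comp (measurable_snd.prodMk ((measurable_pi_apply i).comp measurable_fst))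

lemma risk_mem_Icc (hmeas : Measurable (fun p : Θ × X × Y => ℓ (f p.1 p.2.1) p.2.2))
    (hbound : ∀ y' y : Y, ℓ y' y ∈ Set.Icc 0 C) (θ : Θ) : risk P f ℓ θ ∈ Set.Icc 0 C :=
  integral_mem_Icc (hmeas.comp measurable_prodMk_left) fun _ => hbound _ _

/-- The exponential moment under the prior of the deviation between risk and empirical risk. -/
noncomputable def expDeviation (P : Measure (X × Y)) (f : Θ → X → Y) (ℓ : Y → Y → ℝ)
    (π : Measure Θ) (lam : ℝ) (n : ℕ) (ω : Fin n → X × Y) : ℝ :=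
  ∫ θ, Real.exp (lam * (risk P f ℓ θ - empRisk f ℓ n ω θ)) ∂π

variable {π : Measure Θ} [IsProbabilityMeasure π] {lam : ℝ} {n : ℕ}

lemma measurable_deviation (hmeas : Measurable (fun p : Θ × X × Y => ℓ (f p.1 p.2.1) p.2.2)) :
    Measurable (fun q : (Fin n → X × Y) × Θ =>
      lam * (risk P f ℓ q.2 - empRisk f ℓ n q.1 q.2)) :=
  (((measurable_risk hmeas).comp measurable_snd).sub (measurable_empRisk hmeas n)).const_mul lam

lemma abs_deviation_le (hmeas : Measurable (fun p : Θ × X × Y => ℓ (f p.1 p.2.1) p.2.2))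
    (hbound : ∀ y' y : Y, ℓ y' y ∈ Set.Icc 0 C) (hn : 0 < n) (hlam : 0 < lam)
    (ω : Fin n → X × Y) (θ : Θ) :
    |lam * (risk P f ℓ θ - empRisk f ℓ n ω θ)| ≤ lam * C := by
  have h1 := risk_mem_Icc (P := P) hmeas hbound θ
  have h2 := empRisk_mem_Icc (f := f) hbound hn ω θ
  rw [abs_mul, abs_of_pos hlam]
  refine mul_le_mul_of_nonneg_left (abs_le.2 ⟨?_, ?_⟩) hlam.le <;> linarith [h1.1, h1.2, h2.1, h2.2]

lemma measurable_expDeviation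
    (hmeas : Measurable (fun p : Θ × X × Y => ℓ (f p.1 p.2.1) p.2.2)) :
    Measurable (expDeviation P f ℓ π lam n) :=
  ((measurable_deviation hmeas).exp.stronglyMeasurable.integral_prod_right' (ν := π)).measurable

lemma integral_expDeviation_le
    (hmeas : Measurable (fun p : Θ × X × Y => ℓ (f p.1 p.2.1) p.2.2))
    (hbound : ∀ y' y : Y, ℓ y' y ∈ Set.Icc 0 C) (hn : 0 < n) (hlam : 0 < lam) :
    ∫ ω, expDeviation P f ℓ π lam n ω ∂(Measure.pi fun _ : Fin n => P)
      ≤ Real.exp (lam ^ 2 * C ^ 2 / (8 * n)) := by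
  have h_int : Integrable (fun q : (Fin n → X × Y) × Θ =>
      Real.exp (lam * (risk P f ℓ q.2 - empRisk f ℓ n q.1 q.2)))
      ((Measure.pi fun _ : Fin n => P).prod π) :=
    integrable_exp_of_abs_le (measurable_deviation hmeas)
      fun q => abs_deviation_le hmeas hbound hn hlam q.1 q.2
  have hle : ∀ θ, ∫ ω, Real.exp (lam * (risk P f ℓ θ - empRisk f ℓ n ω θ))
      ∂(Measure.pi fun _ : Fin n => P) ≤ Real.exp (lam ^ 2 * C ^ 2 / (8 * n)) := fun θ =>
    integral_exp_mean_deviation_le (μ := P) (hmeas.comp (measurable_prodMk_left (x := θ)))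
      (fun _ => hbound _ _) hn lam
  calc ∫ ω, expDeviation P f ℓ π lam n ω ∂(Measure.pi fun _ : Fin n => P)
      = ∫ θ, ∫ ω, Real.exp (lam * (risk P f ℓ θ - empRisk f ℓ n ω θ))
          ∂(Measure.pi fun _ : Fin n => P) ∂π := integral_integral_swap h_int
    _ ≤ ∫ _, Real.exp (lam ^ 2 * C ^ 2 / (8 * n)) ∂π :=
        integral_mono h_int.integral_prod_right (integrable_const _) hle
    _ = Real.exp (lam ^ 2 * C ^ 2 / (8 * n)) := by simp

lemma abs_log_expDeviation_le
    (hmeas : Measurable (fun p : Θ × X × Y => ℓ (f p.1 p.2.1) p.2.2))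
    (hbound : ∀ y' y : Y, ℓ y' y ∈ Set.Icc 0 C) (hn : 0 < n) (hlam : 0 < lam)
    (ω : Fin n → X × Y) : |Real.log (expDeviation P f ℓ π lam n ω)| ≤ lam * C :=
  abs_log_integral_exp_le ((measurable_deviation hmeas).comp measurable_prodMk_left)
    fun θ => abs_deviation_le hmeas hbound hn hlam ω θ

lemma expDeviation_pos
    (hmeas : Measurable (fun p : Θ × X × Y => ℓ (f p.1 p.2.1) p.2.2))
    (hbound : ∀ y' y : Y, ℓ y' y ∈ Set.Icc 0 C) (hn : 0 < n) (hlam : 0 < lam)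
    (ω : Fin n → X × Y) : 0 < expDeviation P f ℓ π lam n ω :=
  integral_exp_pos (integrable_exp_of_abs_le
    ((measurable_deviation hmeas).comp measurable_prodMk_left)
    fun θ => abs_deviation_le hmeas hbound hn hlam ω θ)

lemma integral_log_expDeviation_le
    (hmeas : Measurable (fun p : Θ × X × Y => ℓ (f p.1 p.2.1) p.2.2))
    (hbound : ∀ y' y : Y, ℓ y' y ∈ Set.Icc 0 C) (hn : 0 < n) (hlam : 0 < lam) :
    ∫ ω, Real.log (expDeviation P f ℓ π lam n ω) ∂(Measure.pi fun _ : Fin n => P)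
      ≤ lam ^ 2 * C ^ 2 / (8 * n) := by
  have hpos := expDeviation_pos (P := P) (π := π) hmeas hbound hn hlam
  have hlog := integral_le_log_integral_exp (μ := Measure.pi fun _ : Fin n => P)
    (measurable_expDeviation (P := P) (π := π) (lam := lam) hmeas).log
    (abs_log_expDeviation_le hmeas hbound hn hlam)
  simp_rw [Real.exp_log (hpos _)] at hlog
  refine hlog.trans ?_
  by_cases h0 : 0 < ∫ ω, expDeviation P f ℓ π lam n ω ∂(Measure.pi fun _ : Fin n => P)
  · exact (Real.log_le_iff_le_exp h0).2 (integral_expDeviation_le hmeas hbound hn hlam)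
  · rw [le_antisymm (not_lt.1 h0) (integral_nonneg fun ω => (hpos ω).le), Real.log_zero]
    positivity

lemma lintegral_ofReal_eq {m : Measure Θ} [IsProbabilityMeasure m] {g : Θ → ℝ}
    (hm : Measurable g) (hg : ∀ θ, g θ ∈ Set.Icc 0 C) :
    ∫⁻ θ, ENNReal.ofReal (g θ) ∂m = ENNReal.ofReal (∫ θ, g θ ∂m) :=
  (ofReal_integral_eq_lintegral_ofReal (Integrable.of_mem_Icc 0 C hm.aemeasurable (ae_of_all _ hg))
    (ae_of_all _ fun θ => (hg θ).1)).symm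

lemma lintegral_risk_le_of_pointwise
    (hmeas : Measurable (fun p : Θ × X × Y => ℓ (f p.1 p.2.1) p.2.2))
    (hbound : ∀ y' y : Y, ℓ y' y ∈ Set.Icc 0 C) (hn : 0 < n) (hlam : 0 < lam)
    {m : (Fin n → X × Y) → Measure Θ} (hprob : ∀ ω, IsProbabilityMeasure (m ω))
    (hm : Measurable fun ω => ∫ θ, risk P f ℓ θ ∂(m ω)) {G : (Fin n → X × Y) → ℝ≥0∞}
    (hG : ∀ ω, ENNReal.ofReal (∫ θ, risk P f ℓ θ ∂(m ω) + lam * C ^ 2 / (8 * n)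
      - Real.log (expDeviation P f ℓ π lam n ω) / lam) ≤ G ω) :
    ∫⁻ ω, ∫⁻ θ, ENNReal.ofReal (risk P f ℓ θ) ∂(m ω) ∂(Measure.pi fun _ : Fin n => P)
      ≤ ∫⁻ ω, G ω ∂(Measure.pi fun _ : Fin n => P) := by
  have hmem : ∀ ω, ∫ θ, risk P f ℓ θ ∂(m ω) ∈ Set.Icc 0 C := fun ω =>
    integral_mem_Icc (measurable_risk hmeas) (risk_mem_Icc hmeas hbound)
  have h_int : Integrable (fun ω => ∫ θ, risk P f ℓ θ ∂(m ω)) (Measure.pi fun _ : Fin n => P) :=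
    Integrable.of_mem_Icc 0 C hm.aemeasurable (ae_of_all _ hmem)
  have hlog : Integrable (fun ω => Real.log (expDeviation P f ℓ π lam n ω))
      (Measure.pi fun _ : Fin n => P) :=
    integrable_of_abs_le (measurable_expDeviation hmeas).log
      (abs_log_expDeviation_le hmeas hbound hn hlam)
  have hinner : ∀ ω, ∫⁻ θ, ENNReal.ofReal (risk P f ℓ θ) ∂(m ω) =
      ENNReal.ofReal (∫ θ, risk P f ℓ θ ∂(m ω)) := fun ω =>
    lintegral_ofReal_eq (measurable_risk hmeas) (risk_mem_Icc hmeas hbound)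
  simp_rw [hinner]
  rw [← ofReal_integral_eq_lintegral_ofReal h_int (ae_of_all _ fun ω => (hmem ω).1)]
  refine le_trans (ENNReal.ofReal_le_ofReal ?_) ((ofReal_integral_le_lintegral_ofReal
    ((h_int.add (integrable_const (lam * C ^ 2 / (8 * n)))).sub (hlog.div_const lam))).trans
      (lintegral_mono hG))
  have hle : (∫ ω, Real.log (expDeviation P f ℓ π lam n ω) ∂(Measure.pi fun _ : Fin n => P)) / lam
      ≤ lam * C ^ 2 / (8 * n) := by
    refine (div_le_iff₀ hlam).2 ((integral_log_expDeviation_le hmeas hbound hn hlam).trans_eq ?_)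
    ring
  have hadd : Integrable (fun ω => ∫ θ, risk P f ℓ θ ∂(m ω) + lam * C ^ 2 / (8 * n))
      (Measure.pi fun _ : Fin n => P) := h_int.add (integrable_const _)
  simp only [Pi.add_apply, Pi.sub_apply]
  rw [integral_sub hadd (hlog.div_const lam), integral_add h_int (integrable_const _),
    integral_div lam fun ω => Real.log (expDeviation P f ℓ π lam n ω)]
  simp only [integral_const, probReal_univ, one_smul]
  linarith

lemma ofReal_le_objective (hbound : ∀ y' y : Y, ℓ y' y ∈ Set.Icc 0 C)
    (hmeas : Measurable (fun p : Θ × X × Y => ℓ (f p.1 p.2.1) p.2.2)) (hn : 0 < n)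
    (hlam : 0 < lam) (ω : Fin n → X × Y) {ρ : Measure Θ} [IsProbabilityMeasure ρ] {h : Θ → ℝ}
    {b : ℝ} (hm : Measurable h) (hb : ∀ θ, |h θ| ≤ b) :
    ENNReal.ofReal (∫ θ, empRisk f ℓ n ω θ ∂ρ + lam * C ^ 2 / (8 * n)
        + (∫ θ, h θ ∂ρ - Real.log (∫ θ, Real.exp (h θ) ∂π)) / lam) ≤
      (∫⁻ θ, ENNReal.ofReal (empRisk f ℓ n ω θ) ∂ρ) + ENNReal.ofReal (lam * C ^ 2 / (8 * n))
        + KL ρ π / ENNReal.ofReal lam := by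
  rw [lintegral_ofReal_eq (g := empRisk f ℓ n ω)
    ((measurable_empRisk hmeas n).comp measurable_prodMk_left)
    (empRisk_mem_Icc hbound hn ω)]
  refine ENNReal.ofReal_add_le.trans (add_le_add ENNReal.ofReal_add_le ?_)
  rw [ENNReal.ofReal_div_of_pos hlam]
  exact ENNReal.div_le_div_right (ofReal_integral_sub_log_integral_exp_le_KL hm hb) _

lemma measurable_neg_mul_empRisk
    (hmeas : Measurable (fun p : Θ × X × Y => ℓ (f p.1 p.2.1) p.2.2)) :
    Measurable (fun q : (Fin n → X × Y) × Θ => -lam * empRisk f ℓ n q.1 q.2) :=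
  (measurable_empRisk hmeas n).const_mul (-lam)

lemma isProbabilityMeasure_gibbs
    (hmeas : Measurable (fun p : Θ × X × Y => ℓ (f p.1 p.2.1) p.2.2))
    (hbound : ∀ y' y : Y, ℓ y' y ∈ Set.Icc 0 C) (hn : 0 < n) (hlam : 0 < lam)
    (ω : Fin n → X × Y) : IsProbabilityMeasure (gibbs π f ℓ lam n ω) :=
  isProbabilityMeasure_tilted (integrable_exp_of_abs_le
    ((measurable_neg_mul_empRisk hmeas).comp measurable_prodMk_left)
    (abs_neg_mul_empRisk_le hbound hn hlam ω))

lemma measurable_integral_gibbs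
    (hmeas : Measurable (fun p : Θ × X × Y => ℓ (f p.1 p.2.1) p.2.2)) {g : Θ → ℝ}
    (hg : Measurable g) : Measurable fun ω => ∫ θ, g θ ∂(gibbs π f ℓ lam n ω) := by
  have hexp := (measurable_neg_mul_empRisk (lam := lam) (n := n) hmeas).exp
  have hden : Measurable fun ω : Fin n → X × Y =>
      ∫ θ, Real.exp (-lam * empRisk f ℓ n ω θ) ∂π :=
    (hexp.stronglyMeasurable.integral_prod_right' (ν := π)).measurable
  simp_rw [gibbs, integral_tilted]
  exact (((hexp.div (hden.comp measurable_fst)).smul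
    (hg.comp measurable_snd)).stronglyMeasurable.integral_prod_right' (ν := π)).measurable

lemma integral_risk_gibbs_le
    (hmeas : Measurable (fun p : Θ × X × Y => ℓ (f p.1 p.2.1) p.2.2))
    (hbound : ∀ y' y : Y, ℓ y' y ∈ Set.Icc 0 C) (hn : 0 < n) (hlam : 0 < lam)
    (ω : Fin n → X × Y) :
    lam * ∫ θ, risk P f ℓ θ ∂(gibbs π f ℓ lam n ω) ≤
      Real.log (expDeviation P f ℓ π lam n ω)
        - Real.log (∫ θ, Real.exp (-lam * empRisk f ℓ n ω θ) ∂π) := by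
  have := isProbabilityMeasure_gibbs (π := π) hmeas hbound hn hlam ω
  have hexp : Integrable (fun θ => Real.exp (-lam * empRisk f ℓ n ω θ)) π :=
    integrable_exp_of_abs_le ((measurable_neg_mul_empRisk hmeas).comp measurable_prodMk_left)
      (abs_neg_mul_empRisk_le hbound hn hlam ω)
  have hjensen := integral_le_log_integral_exp (μ := gibbs π f ℓ lam n ω) (b := lam * C)
    ((measurable_risk (P := P) hmeas).const_mul lam) fun θ => by
      have h := risk_mem_Icc (P := P) hmeas hbound θ
      rw [abs_mul, abs_of_pos hlam, abs_of_nonneg h.1]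
      exact mul_le_mul_of_nonneg_left h.2 hlam.le
  have hratio : ∫ θ, Real.exp (lam * risk P f ℓ θ) ∂(gibbs π f ℓ lam n ω) =
      expDeviation P f ℓ π lam n ω / ∫ θ, Real.exp (-lam * empRisk f ℓ n ω θ) ∂π := by
    rw [gibbs, integral_exp_tilted, expDeviation]
    congr 2 with θ
    simp only [Pi.add_apply]
    ring_nf
  rwa [hratio, integral_const_mul, Real.log_div (expDeviation_pos hmeas hbound hn hlam ω).ne'
    (integral_exp_pos hexp).ne'] at hjensen

end Loss

/-- PAC-Bayes bound in expectation: for any data-dependent probability measure `ρ̃`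
(a Markov kernel from samples to `Θ`),
`E_S E_{θ∼ρ̃}[R(θ)] ≤ E_S[ E_{θ∼ρ̃}[r(θ)] + λC²/(8n) + KL(ρ̃‖π)/λ ]`; in particular,
for the Gibbs posterior `ρ̂_λ`,
`E_S E_{θ∼ρ̂_λ}[R(θ)] ≤ E_S[ inf_ρ ( E_{θ∼ρ}[r(θ)] + λC²/(8n) + KL(ρ‖π)/λ ) ]`. -/
theorem pac_bayes_bound_in_expectation
    {X Y Θ : Type*} [MeasurableSpace X] [MeasurableSpace Y] [MeasurableSpace Θ]
    (P : Measure (X × Y)) [IsProbabilityMeasure P]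
    (f : Θ → X → Y) (ℓ : Y → Y → ℝ) (C : ℝ) (hC : 0 < C)
    (hmeas : Measurable (fun p : Θ × X × Y => ℓ (f p.1 p.2.1) p.2.2))
    (hbound : ∀ y' y : Y, ℓ y' y ∈ Set.Icc 0 C)
    (π : Measure Θ) [IsProbabilityMeasure π]
    (n : ℕ) (hn : 0 < n) (lam : ℝ) (hlam : 0 < lam)
    (ρ' : Kernel (Fin n → X × Y) Θ) [IsMarkovKernel ρ'] :
    (∫⁻ ω, ∫⁻ θ, ENNReal.ofReal (risk P f ℓ θ) ∂(ρ' ω)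
        ∂(Measure.pi fun _ : Fin n => P) ≤
      ∫⁻ ω, ((∫⁻ θ, ENNReal.ofReal (empRisk f ℓ n ω θ) ∂(ρ' ω))
          + ENNReal.ofReal (lam * C ^ 2 / (8 * n))
          + KL (ρ' ω) π / ENNReal.ofReal lam)
        ∂(Measure.pi fun _ : Fin n => P))
    ∧ (∫⁻ ω, ∫⁻ θ, ENNReal.ofReal (risk P f ℓ θ) ∂(gibbs π f ℓ lam n ω)
        ∂(Measure.pi fun _ : Fin n => P) ≤
      ∫⁻ ω, (⨅ ρ : {ρ : Measure Θ // IsProbabilityMeasure ρ},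
          ((∫⁻ θ, ENNReal.ofReal (empRisk f ℓ n ω θ) ∂ρ.1)
            + ENNReal.ofReal (lam * C ^ 2 / (8 * n))
            + KL ρ.1 π / ENNReal.ofReal lam))
        ∂(Measure.pi fun _ : Fin n => P)) := by
  have hemp : ∀ (ρ : Measure Θ) [IsProbabilityMeasure ρ] (ω : Fin n → X × Y),
      Integrable (empRisk f ℓ n ω) ρ := fun ρ _ ω =>
    Integrable.of_mem_Icc 0 C
      ((measurable_empRisk hmeas n).comp measurable_prodMk_left).aemeasurable
      (ae_of_all _ (empRisk_mem_Icc hbound hn ω))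
  constructor
  · refine lintegral_risk_le_of_pointwise (π := π) hmeas hbound hn hlam (fun ω => inferInstance)
      (measurable_risk hmeas).stronglyMeasurable.integral_kernel.measurable fun ω => ?_
    refine le_trans (ENNReal.ofReal_le_ofReal (le_of_eq ?_))
      (ofReal_le_objective hbound hmeas hn hlam ω
        ((measurable_deviation (P := P) hmeas).comp measurable_prodMk_left)
        fun θ => abs_deviation_le (P := P) hmeas hbound hn hlam ω θ)
    have hrisk : Integrable (risk P f ℓ) (ρ' ω) :=
      Integrable.of_mem_Icc 0 C (measurable_risk hmeas).aemeasurable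
        (ae_of_all _ (risk_mem_Icc hmeas hbound))
    simp only [Function.comp_def]
    rw [integral_const_mul, integral_sub hrisk (hemp _ ω), expDeviation]
    field_simp
    ring
  · refine lintegral_risk_le_of_pointwise (π := π) hmeas hbound hn hlam
      (isProbabilityMeasure_gibbs hmeas hbound hn hlam)
      (measurable_integral_gibbs hmeas (measurable_risk hmeas)) fun ω => le_iInf fun ρ => ?_
    have := ρ.2
    refine le_trans (ENNReal.ofReal_le_ofReal ?_)
      (ofReal_le_objective hbound hmeas hn hlam ω
        ((measurable_neg_mul_empRisk hmeas).comp measurable_prodMk_left)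
        (abs_neg_mul_empRisk_le hbound hn hlam ω))
    simp only [Function.comp_def]
    have hgibbs := integral_risk_gibbs_le (P := P) (π := π) hmeas hbound hn hlam ω
    rw [← sub_nonneg] at hgibbs ⊢
    rw [integral_const_mul]
    refine (div_nonneg hgibbs hlam.le).trans_eq ?_
    field_simp
    ring
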